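/- arXiv:1903.11641 — 6 statements merged into one kernel-verified Lean document; each statement's English description precedes it below -/
import Mathlib

section
/- Let d, n be positive integers with 2d+1 ≤ n. For every unitary matrix U ∈ U(n+1) there exist a real orthogonal matrix A ∈ O(n+1;ℝ), unitary matrices U₁ ∈ U(d+1) and U₂ ∈ U(n−d), and real numbers a₀, …, a_d ∈ [0,2π] such that U = A · M · diag(U₁, U₂), where M is the (n+1)×(n+1) block matrix M = [[Λ₁, Λ₂, 0], [Λ₂, Λ₁, 0], [0, 0, Id_{n−2d−1}]] with Λ₁ = diag(cos a₀, …, cos a_d) and Λ₂ = diag(√−1·sin a₀, …, √−1·sin a_d) both of size d+1, and diag(U₁,U₂) is the block-diagonal (n+1)×(n+1) matrix with blocks U₁ of size d+1 and U₂ of size n−d. -/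
open Matrix

/-- A complex square matrix is real orthogonal if it has real entries and `ᵗA·A = 1`. -/
def IsRealOrthogonal {N : ℕ} (A : Matrix (Fin N) (Fin N) ℂ) : Prop :=
  (∀ i j, (A i j).im = 0) ∧ Aᵀ * A = 1

/-- The `(n+1)×(n+1)` block matrix `[[Λ₁, Λ₂, 0], [Λ₂, Λ₁, 0], [0, 0, Id_{n−2d−1}]]`, where
`Λ₁ = diag(cos a₀, …, cos a_d)` and `Λ₂ = diag(√−1 sin a₀, …, √−1 sin a_d)` are of size `d+1`. -/
noncomputable def middleBlock (d n : ℕ) (a : ℕ → ℝ) : Matrix (Fin (n+1)) (Fin (n+1)) ℂ :=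
  fun i j =>
    if (i : ℕ) ≤ d ∧ (j : ℕ) = (i : ℕ) then (Real.cos (a i) : ℂ)
    else if (i : ℕ) ≤ d ∧ (j : ℕ) = (i : ℕ) + (d+1) then Complex.I * (Real.sin (a i) : ℂ)
    else if (j : ℕ) ≤ d ∧ (i : ℕ) = (j : ℕ) + (d+1) then Complex.I * (Real.sin (a j) : ℂ)
    else if d+1 ≤ (i : ℕ) ∧ (i : ℕ) ≤ 2*d+1 ∧ (j : ℕ) = (i : ℕ) then
      (Real.cos (a ((i : ℕ) - (d+1))) : ℂ)
    else if 2*d+2 ≤ (i : ℕ) ∧ (j : ℕ) = (i : ℕ) then 1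
    else 0

/-- The `(n+1)×(n+1)` block-diagonal matrix `diag(U₁, U₂)` with blocks of sizes `d+1`, `n−d`. -/
def blockDiagTwo (d n : ℕ) (U₁ : Matrix (Fin (d+1)) (Fin (d+1)) ℂ)
    (U₂ : Matrix (Fin (n-d)) (Fin (n-d)) ℂ) : Matrix (Fin (n+1)) (Fin (n+1)) ℂ :=
  fun i j =>
    if h : (i : ℕ) < d+1 ∧ (j : ℕ) < d+1 then U₁ ⟨i, h.1⟩ ⟨j, h.2⟩
    else if h' : d+1 ≤ (i : ℕ) ∧ d+1 ≤ (j : ℕ) then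
      U₂ ⟨(i : ℕ) - (d+1), by have := i.isLt; omega⟩ ⟨(j : ℕ) - (d+1), by have := j.isLt; omega⟩
    else 0

open Module

/-- A conjugate-linear map on a nontrivial finite-dimensional complex inner product space which is
symmetric for the associated complex bilinear form has a unit eigenvector with real eigenvalue. -/
theorem exists_unit_eigenvector_of_antilinear {E : Type*} [NormedAddCommGroup E]
    [InnerProductSpace ℂ E] [FiniteDimensional ℂ E] [Nontrivial E] (T : E →ₗ⋆[ℂ] E)
    (hT : ∀ u v, inner ℂ u (T v) = inner ℂ v (T u)) :
    ∃ v : E, ‖v‖ = 1 ∧ ∃ s : ℝ, T v = (s : ℂ) • v := by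
  let _ : InnerProductSpace ℝ E := InnerProductSpace.complexToReal
  have : FiniteDimensional ℝ E := FiniteDimensional.complexToReal E
  let R : E →ₗ[ℝ] E :=
    { toFun := T
      map_add' := map_add T
      map_smul' := fun c x => by
        have h := map_smulₛₗ T (c : ℂ) x
        simpa using h }
  have hR : R.IsSymmetric := by
    intro x y
    change (inner ℂ (T x) y).re = (inner ℂ x (T y)).re
    rw [hT x y, ← inner_conj_symm, Complex.conj_re]
  obtain ⟨w, hw⟩ := hR.hasEigenvalue_iSup_of_finiteDimensional.exists_hasEigenvector
  generalize (⨆ x : { x : E // x ≠ 0 }, RCLike.re (inner ℝ (R x) (x : E)) / ‖(x : E)‖ ^ 2 : ℝ) = s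
    at hw
  have hws : T w = (s : ℂ) • w := by
    have h : T w = s • w := hw.apply_eq_smul
    simpa using h
  refine ⟨((‖w‖⁻¹ : ℝ) : ℂ) • w, ?_, s, ?_⟩
  · have := norm_ne_zero_iff.2 hw.2
    simp [norm_smul, this]
  · rw [map_smulₛₗ, hws, Complex.conj_ofReal, smul_comm]

/-- A symmetric conjugate-linear map admits orthonormal families of eigenvectors with real
eigenvalues, of any length up to the dimension. -/
theorem exists_orthonormal_eigenvectors_of_antilinear {E : Type*} [NormedAddCommGroup E]
    [InnerProductSpace ℂ E] [FiniteDimensional ℂ E] (T : E →ₗ⋆[ℂ] E)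
    (hT : ∀ u v, inner ℂ u (T v) = inner ℂ v (T u)) (m : ℕ) (hm : m ≤ finrank ℂ E) :
    ∃ v : Fin m → E, Orthonormal ℂ v ∧ ∀ i, ∃ s : ℝ, T (v i) = (s : ℂ) • v i := by
  induction m with
  | zero => exact ⟨Fin.elim0, by simp, fun i => i.elim0⟩
  | succ m ih =>
    obtain ⟨v, hv, hvT⟩ := ih (by omega)
    set K : Submodule ℂ E := (Submodule.span ℂ (Set.range v))ᗮ with hK
    have memK : ∀ x, x ∈ K ↔ ∀ i, inner ℂ (v i) x = 0 := by
      intro x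
      rw [hK, Submodule.mem_orthogonal]
      refine ⟨fun h i => h _ (Submodule.subset_span ⟨i, rfl⟩), fun h u hu => ?_⟩
      induction hu using Submodule.span_induction with
      | mem u hu => obtain ⟨i, rfl⟩ := hu; exact h i
      | zero => simp
      | add a b _ _ ha hb => rw [inner_add_left, ha, hb, add_zero]
      | smul c a _ ha => rw [inner_smul_left, ha, mul_zero]
    have hTK : ∀ x ∈ K, T x ∈ K := by
      intro x hx
      rw [memK] at hx ⊢
      intro i
      obtain ⟨s, hs⟩ := hvT i
      rw [hT, hs, inner_smul_right, ← inner_conj_symm, hx i]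
      simp
    have : Nontrivial K := by
      have h1 := Submodule.finrank_add_finrank_orthogonal (Submodule.span ℂ (Set.range v))
      rw [finrank_span_eq_card hv.linearIndependent, Fintype.card_fin] at h1
      exact Module.nontrivial_of_finrank_pos (R := ℂ) (by rw [hK]; omega)
    let TK : K →ₗ⋆[ℂ] K :=
      { toFun := fun x => ⟨T x, hTK x x.2⟩
        map_add' := fun x y => Subtype.ext (by simp)
        map_smul' := fun c x => Subtype.ext (by simp) }
    obtain ⟨w, hw, s, hs⟩ := exists_unit_eigenvector_of_antilinear TK
      (fun u v => hT (u : E) (v : E))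
    have hwv : ∀ i, inner ℂ (v i) (w : E) = 0 := (memK _).1 w.2
    have hvw : ∀ i, inner ℂ (w : E) (v i) = 0 := fun i => inner_eq_zero_symm.1 (hwv i)
    have hww : inner ℂ (w : E) (w : E) = 1 := by
      rw [inner_self_eq_norm_sq_to_K, ← Submodule.coe_norm, hw]; simp
    refine ⟨Fin.cons (w : E) v, ?_, ?_⟩
    · rw [orthonormal_iff_ite] at hv ⊢
      intro i j
      refine Fin.cases ?_ (fun i => ?_) i <;> refine Fin.cases ?_ (fun j => ?_) j
      · simpa using hww
      · simp [hvw, (Fin.succ_ne_zero _).symm]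
      · simp [hwv]
      · simp [hv]
    · intro i
      refine Fin.cases ⟨s, ?_⟩ (fun i => ?_) i
      · have h : T w = ((s : ℂ) • w : K) := congrArg Subtype.val hs
        simpa using h
      · simpa using hvT i

/-- Autonne–Takagi factorization: a complex symmetric matrix becomes real diagonal after a
unitary congruence. -/
theorem Matrix.exists_unitary_congruence_diagonal {k : ℕ} (S : Matrix (Fin k) (Fin k) ℂ)
    (hS : Sᵀ = S) :
    ∃ (P : Matrix (Fin k) (Fin k) ℂ) (s : Fin k → ℝ),
      Pᴴ * P = 1 ∧ Pᵀ * S * P = diagonal fun i => (s i : ℂ) := by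
  let T : EuclideanSpace ℂ (Fin k) →ₗ⋆[ℂ] EuclideanSpace ℂ (Fin k) :=
    { toFun := fun v => WithLp.toLp 2 (star (S *ᵥ WithLp.ofLp v))
      map_add' := fun x y => by
        simp [mulVec_add]
      map_smul' := fun c x => by
        simp [mulVec_smul] }
  have hT : ∀ u v, inner ℂ u (T v) = inner ℂ v (T u) := by
    intro u v
    simp only [EuclideanSpace.inner_eq_star_dotProduct]
    change star (S *ᵥ v.ofLp) ⬝ᵥ star u.ofLp = star (S *ᵥ u.ofLp) ⬝ᵥ star v.ofLp
    rw [star_dotProduct_star, star_dotProduct_star]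
    congr 1
    rw [dotProduct_mulVec, ← mulVec_transpose, hS, dotProduct_comm]
  obtain ⟨v, hv, hvT⟩ := exists_orthonormal_eigenvectors_of_antilinear T hT k (by simp)
  choose s hs using hvT
  have hP : (of fun i j => v j i)ᴴ * (of fun i j => v j i) = (1 : Matrix (Fin k) (Fin k) ℂ) := by
    ext i j
    rw [orthonormal_iff_ite] at hv
    rw [one_apply, ← hv i j, EuclideanSpace.inner_eq_star_dotProduct]
    simp [mul_apply, dotProduct, mul_comm]
  refine ⟨of fun i j => v j i, s, hP, ?_⟩
  have hSP : S * (of fun i j => v j i) =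
      ((of fun i j => v j i)ᴴ)ᵀ * diagonal fun i => (s i : ℂ) := by
    ext i j
    have h := congrArg (fun x : EuclideanSpace ℂ (Fin k) => star (x i)) (hs j)
    simp only [T, LinearMap.coe_mk, AddHom.coe_mk, Pi.star_apply, star_star] at h
    rw [mul_diagonal]
    simpa [mul_apply, mulVec, dotProduct, mul_comm] using h
  rw [Matrix.mul_assoc, hSP, ← Matrix.mul_assoc, ← transpose_mul, hP, transpose_one,
    Matrix.one_mul]

/-- A pairwise orthogonal family indexed by the dimension consists of multiples of the vectors of
an orthonormal basis. -/
theorem exists_orthonormalBasis_norm_smul {E ι : Type*} [NormedAddCommGroup E]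
    [InnerProductSpace ℝ E] [FiniteDimensional ℝ E] [Fintype ι]
    (hι : finrank ℝ E = Fintype.card ι) (w : ι → E)
    (hw : Pairwise fun i j => inner ℝ (w i) (w j) = 0) :
    ∃ b : OrthonormalBasis ι ℝ E, ∀ i, w i = ‖w i‖ • b i := by
  classical
  have h : Orthonormal ℝ (Set.domRestrict {i | w i ≠ 0} fun i => ‖w i‖⁻¹ • w i) := by
    refine ⟨fun i => ?_, fun i j hij => ?_⟩
    · have := norm_ne_zero_iff.2 i.2
      simp [norm_smul, this]
    · have := hw (fun h => hij (Subtype.ext h))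
      simp [inner_smul_left, inner_smul_right, this]
  obtain ⟨b, hb⟩ := h.exists_orthonormalBasis_extension_of_card_eq hι
  refine ⟨b, fun i => ?_⟩
  by_cases hi : w i = 0
  · simp [hi]
  · rw [hb i hi, smul_smul, mul_inv_cancel₀ (norm_ne_zero_iff.2 hi), one_smul]

/-- The middle factor `[[cos a, √-1 sin a, 0], [√-1 sin a, cos a, 0], [0, 0, 1]]`, with diagonal
blocks, indexed by a sum type. -/
noncomputable def cosSinBlock (κ μ : Type*) [DecidableEq κ] [DecidableEq μ] (a : κ → ℝ) :
    Matrix (κ ⊕ (κ ⊕ μ)) (κ ⊕ (κ ⊕ μ)) ℂ :=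
  fromBlocks (diagonal fun j => (Real.cos (a j) : ℂ))
    (fromCols (diagonal fun j => Complex.I * (Real.sin (a j) : ℂ)) 0)
    (fromRows (diagonal fun j => Complex.I * (Real.sin (a j) : ℂ)) 0)
    (fromBlocks (diagonal fun j => (Real.cos (a j) : ℂ)) 0 0 1)

theorem cosSinBlock_conjTranspose_mul_self {κ μ : Type*} [Fintype κ] [Fintype μ] [DecidableEq κ]
    [DecidableEq μ] (a : κ → ℝ) : (cosSinBlock κ μ a)ᴴ * cosSinBlock κ μ a = 1 := by
  have hc : ∀ j, (starRingEnd ℂ) (Complex.cos (a j)) = Complex.cos (a j) := fun j => by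
    rw [← Complex.ofReal_cos, Complex.conj_ofReal]
  have hs : ∀ j, (starRingEnd ℂ) (Complex.I * Complex.sin (a j)) = -(Complex.I * Complex.sin (a j)) :=
    fun j => by rw [map_mul, ← Complex.ofReal_sin, Complex.conj_ofReal, Complex.conj_I, neg_mul]
  ext (i | i | i) (j | j | j) <;>
    simp [cosSinBlock, mul_apply, one_apply, diagonal_apply, eq_comm (a := j)] <;>
    split_ifs with hij <;> try simp only [map_zero, zero_mul, add_zero]
  all_goals
    subst hij
    rw [hc, hs]
    first
      | ring1
      | linear_combination Complex.cos_sq_add_sin_sq (a i) - Complex.sin (a i) ^ 2 * Complex.I_sq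

/-- If the columns of `V` are orthonormal and `Vᵀ * V` is real diagonal, then, up to a real
orthogonal matrix, `V` has the form `[cos a, √-1 sin a, 0]`. -/
theorem exists_orthogonal_cos_sin {k : ℕ} {μ : Type*} [Fintype μ] [DecidableEq μ]
    (V : Matrix (Fin k ⊕ (Fin k ⊕ μ)) (Fin k) ℂ) (s : Fin k → ℝ) (hV : Vᴴ * V = 1)
    (hVs : Vᵀ * V = diagonal fun i => (s i : ℂ)) :
    ∃ (B : Matrix (Fin k ⊕ (Fin k ⊕ μ)) (Fin k ⊕ (Fin k ⊕ μ)) ℝ) (a : Fin k → ℝ),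
      Bᵀ * B = 1 ∧ (∀ j, a j ∈ Set.Icc 0 (2 * Real.pi)) ∧
      V = B.map Complex.ofReal * (cosSinBlock (Fin k) μ a).toCols₁ := by
  let x : Fin k → EuclideanSpace ℝ (Fin k ⊕ (Fin k ⊕ μ)) :=
    fun j => WithLp.toLp 2 fun r => (V r j).re
  let y : Fin k → EuclideanSpace ℝ (Fin k ⊕ (Fin k ⊕ μ)) :=
    fun j => WithLp.toLp 2 fun r => (V r j).im
  have h1 : ∀ i j, inner ℝ (x i) (x j) + inner ℝ (y i) (y j) = if i = j then 1 else 0 := by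
    intro i j
    have h := congrArg Complex.re (congrFun (congrFun hV i) j)
    rw [one_apply, apply_ite Complex.re, Complex.one_re, Complex.zero_re] at h
    rw [← h]
    simp [x, y, PiLp.inner_apply, mul_apply, -Fintype.sum_sum_type, Finset.sum_add_distrib,
      mul_comm]
  have h2 : ∀ i j, inner ℝ (x i) (y j) - inner ℝ (y i) (x j) = 0 := by
    intro i j
    have h := congrArg Complex.im (congrFun (congrFun hV i) j)
    rw [one_apply, apply_ite Complex.im, Complex.one_im, Complex.zero_im, ite_self] at h
    rw [← h]
    simp [x, y, PiLp.inner_apply, mul_apply, -Fintype.sum_sum_type, Finset.sum_add_distrib,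
      mul_comm]
    ring
  have h3 : ∀ i j, i ≠ j → inner ℝ (x i) (x j) - inner ℝ (y i) (y j) = 0 := by
    intro i j hij
    have h := congrArg Complex.re (congrFun (congrFun hVs i) j)
    rw [diagonal_apply_ne _ hij, Complex.zero_re] at h
    rw [← h]
    simp [x, y, PiLp.inner_apply, mul_apply, -Fintype.sum_sum_type, Finset.sum_sub_distrib,
      mul_comm]
  have h4 : ∀ i j, inner ℝ (x i) (y j) + inner ℝ (y i) (x j) = 0 := by
    intro i j
    have h := congrArg Complex.im (congrFun (congrFun hVs i) j)
    rw [diagonal_apply, apply_ite Complex.im, Complex.ofReal_im, Complex.zero_im, ite_self] at h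
    rw [← h]
    simp [x, y, PiLp.inner_apply, mul_apply, -Fintype.sum_sum_type, Finset.sum_add_distrib,
      mul_comm]
  have hxx : ∀ i j, i ≠ j → inner ℝ (x i) (x j) = 0 := by
    intro i j hij
    have := h1 i j
    rw [if_neg hij] at this
    linarith [h3 i j hij]
  have hyy : ∀ i j, i ≠ j → inner ℝ (y i) (y j) = 0 := by
    intro i j hij
    linarith [h3 i j hij, hxx i j hij]
  have hxy : ∀ i j, inner ℝ (x i) (y j) = 0 := fun i j => by linarith [h2 i j, h4 i j]
  have hyx : ∀ i j, inner ℝ (y i) (x j) = 0 := fun i j => by linarith [h2 i j, h4 i j]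
  have hnorm : ∀ j, ‖x j‖ ^ 2 + ‖y j‖ ^ 2 = 1 := fun j => by
    simpa [real_inner_self_eq_norm_sq] using h1 j j
  obtain ⟨b, hb⟩ := exists_orthonormalBasis_norm_smul (by simp)
    (Sum.elim x (Sum.elim y (fun _ : μ => 0))) (by
      rintro (i | i | i) (j | j | j) hij <;> simp_all)
  have hcos : ∀ j, Real.cos (Real.arccos ‖x j‖) = ‖x j‖ := fun j =>
    Real.cos_arccos (by linarith [norm_nonneg (x j)]) (by nlinarith [hnorm j, sq_nonneg ‖y j‖])
  have hsin : ∀ j, Real.sin (Real.arccos ‖x j‖) = ‖y j‖ := fun j => by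
    rw [Real.sin_arccos, ← hnorm j, add_sub_cancel_left, Real.sqrt_sq (norm_nonneg _)]
  refine ⟨of fun r j => b j r, fun j => Real.arccos ‖x j‖, ?_, fun j => ⟨Real.arccos_nonneg _, ?_⟩,
    ?_⟩
  · ext i j
    rw [one_apply, ← orthonormal_iff_ite.1 b.orthonormal i j, PiLp.inner_apply]
    simp [mul_apply, -Fintype.sum_sum_type, mul_comm]
  · linarith [Real.arccos_le_pi ‖x j‖, Real.pi_pos]
  · ext r j
    have hx : (V r j).re = ‖x j‖ * b (Sum.inl j) r :=
      congrArg (fun z : EuclideanSpace ℝ (Fin k ⊕ (Fin k ⊕ μ)) => z r) (hb (Sum.inl j))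
    have hy : (V r j).im = ‖y j‖ * b (Sum.inr (Sum.inl j)) r :=
      congrArg (fun z : EuclideanSpace ℝ (Fin k ⊕ (Fin k ⊕ μ)) => z r) (hb (Sum.inr (Sum.inl j)))
    rw [← Complex.re_add_im (V r j), hx, hy, ← hcos j, ← hsin j]
    simp [cosSinBlock, mul_apply, diagonal_apply]
    ring

/-- The decomposition `U = A * M * diag(U₁, U₂)` for matrices indexed by a sum type. -/
theorem exists_orthogonal_cosSinBlock_fromBlocks {k : ℕ} {μ : Type*} [Fintype μ] [DecidableEq μ]
    (U : Matrix (Fin k ⊕ (Fin k ⊕ μ)) (Fin k ⊕ (Fin k ⊕ μ)) ℂ) (hU : Uᴴ * U = 1) :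
    ∃ (B : Matrix (Fin k ⊕ (Fin k ⊕ μ)) (Fin k ⊕ (Fin k ⊕ μ)) ℝ) (a : Fin k → ℝ)
      (U₁ : Matrix (Fin k) (Fin k) ℂ) (U₂ : Matrix (Fin k ⊕ μ) (Fin k ⊕ μ) ℂ),
      Bᵀ * B = 1 ∧ (∀ j, a j ∈ Set.Icc 0 (2 * Real.pi)) ∧ U₁ᴴ * U₁ = 1 ∧ U₂ᴴ * U₂ = 1 ∧
      U = B.map Complex.ofReal * cosSinBlock (Fin k) μ a * fromBlocks U₁ 0 0 U₂ := by
  have hV : U.toCols₁ᴴ * U.toCols₁ = 1 := by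
    ext i j
    simpa [mul_apply, one_apply] using congrFun (congrFun hU (Sum.inl i)) (Sum.inl j)
  obtain ⟨P, s, hP, hPs⟩ := Matrix.exists_unitary_congruence_diagonal (U.toCols₁ᵀ * U.toCols₁)
    (by rw [transpose_mul, transpose_transpose])
  have hP' : P * Pᴴ = 1 := mul_eq_one_comm.1 hP
  obtain ⟨B, a, hB, ha, hVP⟩ := exists_orthogonal_cos_sin (U.toCols₁ * P) s
    (by rw [conjTranspose_mul, Matrix.mul_assoc, ← Matrix.mul_assoc _ _ P, hV, Matrix.one_mul, hP])
    (by rw [transpose_mul, ← hPs]; simp only [Matrix.mul_assoc])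
  set Q := B.map Complex.ofReal * cosSinBlock (Fin k) μ a with hQ
  have hBB : (B.map Complex.ofReal)ᴴ * B.map Complex.ofReal = 1 := by
    ext i j
    have h := congrArg Complex.ofReal (congrFun (congrFun hB i) j)
    simpa [mul_apply, one_apply, apply_ite Complex.ofReal] using h
  have hQQ : Qᴴ * Q = 1 := by
    rw [hQ, conjTranspose_mul, Matrix.mul_assoc, ← Matrix.mul_assoc _ _ (cosSinBlock _ _ _), hBB,
      Matrix.one_mul, cosSinBlock_conjTranspose_mul_self]
  have hQQ' : Q * Qᴴ = 1 := mul_eq_one_comm.1 hQQ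
  have hV' : U.toCols₁ = Q * (fromRows Pᴴ 0 : Matrix (Fin k ⊕ (Fin k ⊕ μ)) (Fin k) ℂ) := by
    have h : Q * (fromRows 1 0 : Matrix (Fin k ⊕ (Fin k ⊕ μ)) (Fin k) ℂ) = U.toCols₁ * P := by
      rw [hVP, hQ, Matrix.mul_assoc]
      congr 1
      ext i j
      simp [mul_apply, one_apply]
    calc U.toCols₁ = U.toCols₁ * P * Pᴴ := by rw [Matrix.mul_assoc, hP', Matrix.mul_one]
      _ = _ := by rw [← h, Matrix.mul_assoc, fromRows_mul, Matrix.one_mul, Matrix.zero_mul]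
  obtain ⟨D, hD⟩ : ∃ D, D = Qᴴ * U := ⟨_, rfl⟩
  have hUD : U = Q * D := by rw [hD, ← Matrix.mul_assoc, hQQ', Matrix.one_mul]
  have hDD : Dᴴ * D = 1 := by
    rw [hD, conjTranspose_mul, conjTranspose_conjTranspose, Matrix.mul_assoc,
      ← Matrix.mul_assoc Q, hQQ', Matrix.one_mul, hU]
  have hDcols : D.toCols₁ = fromRows Pᴴ 0 := by
    have h : D.toCols₁ = Qᴴ * U.toCols₁ := by rw [hD]; rfl
    rw [h, hV', ← Matrix.mul_assoc, hQQ, Matrix.one_mul]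
  have hD₁ : D.toBlocks₁₁ = Pᴴ := by
    ext i j
    exact congrFun (congrFun hDcols (Sum.inl i)) j
  have hD₂ : D.toBlocks₂₁ = 0 := by
    ext i j
    exact congrFun (congrFun hDcols (Sum.inr i)) j
  rw [← fromBlocks_toBlocks D, hD₁, hD₂, fromBlocks_conjTranspose, fromBlocks_multiply,
    ← fromBlocks_one, fromBlocks_inj] at hDD
  obtain ⟨-, h12, -, h22⟩ := hDD
  have hD₃ : D.toBlocks₁₂ = 0 := by
    rw [conjTranspose_conjTranspose, conjTranspose_zero, Matrix.zero_mul, add_zero] at h12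
    rw [← Matrix.one_mul D.toBlocks₁₂, ← hP, Matrix.mul_assoc, h12, Matrix.mul_zero]
  refine ⟨B, a, Pᴴ, D.toBlocks₂₂, hB, ha, by rw [conjTranspose_conjTranspose, hP'], ?_, ?_⟩
  · simpa [hD₃] using h22
  · rw [← hQ, hUD]
    congr 1
    conv_lhs => rw [← fromBlocks_toBlocks D, hD₁, hD₂, hD₃]

/-- decomposition of a unitary matrix `U ∈ U(n+1)` when `2d+1 ≤ n`:
`U = A · M · diag(U₁,U₂)` with `A` real orthogonal, `U₁ ∈ U(d+1)`, `U₂ ∈ U(n−d)`, and `M` the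
block matrix `[[Λ₁, Λ₂, 0], [Λ₂, Λ₁, 0], [0, 0, Id]]` for some `a₀, …, a_d ∈ [0, 2π]`. -/
theorem stmt0 (d n : ℕ) (hd : 0 < d) (hn : 2*d+1 ≤ n)
    (U : Matrix (Fin (n+1)) (Fin (n+1)) ℂ) (hU : Uᴴ * U = 1) :
    ∃ (A : Matrix (Fin (n+1)) (Fin (n+1)) ℂ) (U₁ : Matrix (Fin (d+1)) (Fin (d+1)) ℂ)
      (U₂ : Matrix (Fin (n-d)) (Fin (n-d)) ℂ) (a : ℕ → ℝ),
      IsRealOrthogonal A ∧ U₁ᴴ * U₁ = 1 ∧ U₂ᴴ * U₂ = 1 ∧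
      (∀ j ≤ d, a j ∈ Set.Icc (0:ℝ) (2 * Real.pi)) ∧
      U = A * middleBlock d n a * blockDiagTwo d n U₁ U₂ := by
  let f : Fin (d+1) ⊕ Fin (n-2*d-1) ≃ Fin (n-d) :=
    finSumFinEquiv.trans (finCongr (by omega))
  let e : Fin (d+1) ⊕ (Fin (d+1) ⊕ Fin (n-2*d-1)) ≃ Fin (n+1) :=
    ((Equiv.refl _).sumCongr f).trans (finSumFinEquiv.trans (finCongr (by omega)))
  have f_inl : ∀ i, (f (Sum.inl i) : ℕ) = i := fun i => by simp [f]
  have f_inr : ∀ i, (f (Sum.inr i) : ℕ) = d + 1 + i := fun i => by simp [f]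
  have e_inl : ∀ i, (e (Sum.inl i) : ℕ) = i := fun i => by simp [e]
  have e_inr : ∀ i, (e (Sum.inr i) : ℕ) = d + 1 + f i := fun i => by simp [e]
  have hUe : (U.submatrix e e)ᴴ * U.submatrix e e = 1 := by
    rw [conjTranspose_submatrix, submatrix_mul_equiv, hU, submatrix_one_equiv]
  obtain ⟨B, a, U₁, U₂, hB, ha, hU₁, hU₂, hdecomp⟩ :=
    exists_orthogonal_cosSinBlock_fromBlocks (U.submatrix e e) hUe
  let a' : ℕ → ℝ := fun j => if h : j < d + 1 then a ⟨j, h⟩ else 0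
  have ha' : ∀ i : Fin (d+1), a' i = a i := fun i => dif_pos i.2
  have hM : (middleBlock d n a').submatrix e e = cosSinBlock _ _ a := by
    ext (i | i | i) (j | j | j) <;>
      simp [cosSinBlock, middleBlock, e_inl, e_inr, f_inl, f_inr, ha', diagonal_apply,
        one_apply] <;>
      grind
  have hD : (blockDiagTwo d n U₁ (U₂.submatrix f.symm f.symm)).submatrix e e =
      fromBlocks U₁ 0 0 U₂ := by
    have hlt : ∀ i : Fin (d+1), ¬ d + 1 ≤ (i : ℕ) := fun i => by omega
    have hge : ∀ i, ¬ d + 1 + (f i : ℕ) < d + 1 := fun i => by omega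
    ext (i | i) (j | j) <;>
      simp only [submatrix_apply, blockDiagTwo, e_inl, e_inr, hlt, hge, Fin.is_lt, Fin.eta,
        and_self, and_true, and_false, dite_true, dite_false,
        Nat.le_add_right, Nat.add_sub_cancel_left, Equiv.symm_apply_apply, fromBlocks_apply₁₁,
        fromBlocks_apply₁₂, fromBlocks_apply₂₁, fromBlocks_apply₂₂, Matrix.zero_apply]
  refine ⟨(B.map Complex.ofReal).submatrix e.symm e.symm, U₁, U₂.submatrix f.symm f.symm, a',
    ⟨fun i j => by simp, ?_⟩, hU₁, ?_, fun j hj => ?_, ?_⟩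
  · rw [transpose_submatrix, submatrix_mul_equiv, ← submatrix_one_equiv e.symm]
    congr 1
    ext i j
    have h := congrArg Complex.ofReal (congrFun (congrFun hB i) j)
    simpa [mul_apply, one_apply, apply_ite Complex.ofReal] using h
  · rw [conjTranspose_submatrix, submatrix_mul_equiv, hU₂, submatrix_one_equiv]
  · have := ha ⟨j, by omega⟩
    rwa [← ha'] at this
  · apply (reindex e.symm e.symm).injective
    rw [reindex_apply, reindex_apply, Equiv.symm_symm, ← submatrix_mul_equiv _ _ e e e,
      ← submatrix_mul_equiv _ _ e e e, hM, hD, hdecomp]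
    simp
end

section
/- For every natural number m and for t = 2m as well as for t = 2m+1, the (m+1)×(m+1) real matrix whose (k,i) entry is i^{2k} + (t−i)^{2k} for 0 ≤ k, i ≤ m (with the convention 0⁰ = 1) is invertible. -/
open Matrix

open Polynomial in
/-- The even part `((a + x) ^ (2k) + (a - x) ^ (2k)) / 2` is a monic polynomial of degree `k`
in `x ^ 2`. -/
theorem exists_monic_eval_sq_eq_add_pow_add_sub_pow {R : Type*} [CommRing R] [Nontrivial R]
    (a : R) (k : ℕ) :
    ∃ q : R[X], q.natDegree = k ∧ q.Monic ∧
      ∀ x, 2 * q.eval (x ^ 2) = (a + x) ^ (2 * k) + (a - x) ^ (2 * k) := by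
  suffices h : ∃ q : R[X], q.natDegree ≤ k ∧ q.coeff k = 1 ∧
      ∀ x, 2 * q.eval (x ^ 2) = (a + x) ^ (2 * k) + (a - x) ^ (2 * k) by
    obtain ⟨q, hdeg, hcoeff, heval⟩ := h
    exact ⟨q, natDegree_eq_of_le_of_coeff_ne_zero hdeg (by simp [hcoeff]),
      monic_of_natDegree_le_of_coeff_eq_one k hdeg hcoeff, heval⟩
  induction k using Nat.twoStepInduction with
  | zero => exact ⟨1, by simp, by simp, fun x => by simp; norm_num⟩
  | one =>
    refine ⟨X + C (a ^ 2), by compute_degree, by compute_degree!, fun x => ?_⟩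
    simp only [eval_add, eval_X, eval_C]
    ring
  | more k ih₀ ih₁ =>
    obtain ⟨q₀, hdeg₀, hcoeff₀, heval₀⟩ := ih₀
    obtain ⟨q₁, hdeg₁, hcoeff₁, heval₁⟩ := ih₁
    have hlin : (2 * (X + C (a ^ 2)) : R[X]).natDegree ≤ 1 := by compute_degree
    have hsq : ((X - C (a ^ 2)) ^ 2 : R[X]).natDegree ≤ 2 := by compute_degree
    have hlin' : (2 * (X + C (a ^ 2)) : R[X]).coeff 1 = 2 := by
      compute_degree!
    have hsq' : ((X - C (a ^ 2)) ^ 2 : R[X]).coeff 2 = 1 := by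
      compute_degree!
    refine ⟨2 * (X + C (a ^ 2)) * q₁ - (X - C (a ^ 2)) ^ 2 * q₀, ?_, ?_, fun x => ?_⟩
    · refine (natDegree_sub_le _ _).trans (max_le ?_ ?_)
      · exact (natDegree_mul_le_of_le hlin hdeg₁).trans (by lia)
      · exact (natDegree_mul_le_of_le hsq hdeg₀).trans (by lia)
    · have h₁ := coeff_mul_add_eq_of_natDegree_le hlin hdeg₁
      have h₀ := coeff_mul_add_eq_of_natDegree_le hsq hdeg₀
      rw [show 1 + (k + 1) = k + 2 by lia, hlin', hcoeff₁] at h₁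
      rw [show 2 + k = k + 2 by lia, hsq', hcoeff₀] at h₀
      rw [coeff_sub, h₁, h₀]
      norm_num
    · simp only [eval_sub, eval_mul, eval_add, eval_pow, eval_X, eval_C, eval_ofNat]
      linear_combination 2 * (x ^ 2 + a ^ 2) * heval₁ x - (x ^ 2 - a ^ 2) ^ 2 * heval₀ x

/-- for every natural number `m` and for `t = 2m` as well as `t = 2m+1`, the
`(m+1)×(m+1)` real matrix with `(k,i)` entry `i^{2k} + (t−i)^{2k}` (convention `0⁰ = 1`) is
invertible. -/
theorem stmt8 (m t : ℕ) (ht : t = 2*m ∨ t = 2*m + 1) :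
    IsUnit (Matrix.of (fun k i : Fin (m+1) =>
      ((i : ℕ) : ℝ) ^ (2 * (k : ℕ)) + ((t - (i : ℕ) : ℕ) : ℝ) ^ (2 * (k : ℕ)))) := by
  choose q hdeg hmonic heval using
    exists_monic_eval_sq_eq_add_pow_add_sub_pow ((t : ℝ) / 2)
  let v : Fin (m + 1) → ℝ := fun i => ((i : ℝ) - t / 2) ^ 2
  have hv : Function.Injective v := by
    intro i j hij
    by_contra hne
    have hlt : (i : ℕ) + j < t := by
      have := Fin.val_ne_of_ne hne
      lia
    have hlt' : (i : ℝ) + j < t := by exact_mod_cast hlt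
    have hprod : ((i : ℝ) - j) * (i + j - t) = 0 := by
      simp only [v] at hij
      linear_combination hij
    rcases mul_eq_zero.mp hprod with h | h
    · exact hne (Fin.ext (by exact_mod_cast sub_eq_zero.mp h))
    · linarith
  have hdet := det_eval_matrixOfPolynomials_eq_det_vandermonde v (fun k => q k)
    (fun k => hdeg k) (fun k => hmonic k)
  have hmat : (Matrix.of (fun k i : Fin (m+1) =>
      ((i : ℕ) : ℝ) ^ (2 * (k : ℕ)) + ((t - (i : ℕ) : ℕ) : ℝ) ^ (2 * (k : ℕ)))) =
      (2 : ℝ) • (Matrix.of fun i k : Fin (m + 1) => (q k).eval (v i))ᵀ := by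
    ext k i
    have hle : (i : ℕ) ≤ t := by lia
    simp only [of_apply, Matrix.smul_apply, transpose_apply, smul_eq_mul, v, heval, Nat.cast_sub hle]
    ring_nf
  rw [hmat, isUnit_iff_isUnit_det, det_smul, det_transpose, ← hdet, isUnit_iff_ne_zero]
  exact mul_ne_zero (by positivity) (det_vandermonde_ne_zero_iff.mpr hv)
end

section
/- Let k ≥ 1 be an integer, let ε₀, …, ε_k be real numbers with 0 < ε₀ < ε₁ < ⋯ < ε_k, and let x₀, …, x_{k−1} be real numbers with 0 ≤ x₀ ≤ x₁ ≤ ⋯ ≤ x_{k−1} ≤ 1. Define x_k by x_k·ε_k = ∑_{j=0}^{(k−2)/2} (x_{2j+1}·ε_{2j+1} − x_{2j}·ε_{2j}) if k is even, and by x_k·ε_k = x₀·ε₀ + ∑_{j=1}^{(k−1)/2} (x_{2j}·ε_{2j} − x_{2j−1}·ε_{2j−1}) if k is odd. Then x_k ≥ 0 and x_k·ε_k ≤ x_{k−1}·ε_{k−1}; in particular, 0 ≤ x_k < x_{k−1} whenever x_{k−1} > 0. -/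
lemma sum_range_odd_sub_even_mem_Icc (y : ℕ → ℝ) (h0 : 0 ≤ y 0) (m : ℕ)
    (h : ∀ i < 2 * m + 1, y i ≤ y (i + 1)) :
    ∑ j ∈ Finset.range (m + 1), (y (2 * j + 1) - y (2 * j)) ∈ Set.Icc 0 (y (2 * m + 1)) := by
  induction m with
  | zero =>
    have := h 0 (by norm_num)
    simp_all
  | succ m ih =>
    obtain ⟨hl, hu⟩ := ih fun i hi => h i (by omega)
    have h1 := h (2 * m + 1) (by omega)
    have h2 := h (2 * m + 2) (by omega)
    rw [Finset.sum_range_succ]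
    simp only [mul_add, mul_one] at *
    constructor <;> linarith

lemma add_sum_Icc_even_sub_odd_mem_Icc (y : ℕ → ℝ) (h0 : 0 ≤ y 0) (m : ℕ)
    (h : ∀ i < 2 * m, y i ≤ y (i + 1)) :
    y 0 + ∑ j ∈ Finset.Icc 1 m, (y (2 * j) - y (2 * j - 1)) ∈ Set.Icc 0 (y (2 * m)) := by
  induction m with
  | zero => simpa using h0
  | succ m ih =>
    obtain ⟨hl, hu⟩ := ih fun i hi => h i (by omega)
    have h1 := h (2 * m) (by omega)
    have h2 := h (2 * m + 1) (by omega)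
    rw [Finset.sum_Icc_succ_top (by omega), show 2 * (m + 1) - 1 = 2 * m + 1 by omega]
    simp only [mul_add, mul_one] at *
    constructor <;> linarith

/-- given `0 < ε₀ < ⋯ < ε_k` and `0 ≤ x₀ ≤ ⋯ ≤ x_{k−1} ≤ 1`, if `x_k` is defined
by `x_k ε_k = ∑_{j=0}^{(k−2)/2} (x_{2j+1} ε_{2j+1} − x_{2j} ε_{2j})` when `k` is even, and by
`x_k ε_k = x₀ ε₀ + ∑_{j=1}^{(k−1)/2} (x_{2j} ε_{2j} − x_{2j−1} ε_{2j−1})` when `k` is odd, then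
`x_k ≥ 0` and `x_k ε_k ≤ x_{k−1} ε_{k−1}`; in particular `0 ≤ x_k < x_{k−1}` whenever
`x_{k−1} > 0`. -/
theorem stmt9 (k : ℕ) (hk : 1 ≤ k) (ε x : ℕ → ℝ)
    (hε0 : 0 < ε 0) (hεmono : ∀ i < k, ε i < ε (i+1))
    (hx0 : 0 ≤ x 0) (hxmono : ∀ i, i + 1 < k → x i ≤ x (i+1)) (hx1 : x (k-1) ≤ 1)
    (hdefeven : Even k →
      x k * ε k = ∑ j ∈ Finset.range (k/2), (x (2*j+1) * ε (2*j+1) - x (2*j) * ε (2*j)))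
    (hdefodd : ¬ Even k →
      x k * ε k = x 0 * ε 0 +
        ∑ j ∈ Finset.Icc 1 ((k-1)/2), (x (2*j) * ε (2*j) - x (2*j-1) * ε (2*j-1))) :
    0 ≤ x k ∧ x k * ε k ≤ x (k-1) * ε (k-1) ∧ (0 < x (k-1) → x k < x (k-1)) := by
  have hε : ∀ i ≤ k, 0 < ε i := by
    intro i
    induction i with
    | zero => exact fun _ => hε0
    | succ i ih => exact fun hi => (ih (by omega)).trans (hεmono i hi)
  have hx : ∀ i < k, 0 ≤ x i := by
    intro i
    induction i with
    | zero => exact fun _ => hx0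
    | succ i ih => exact fun hi => (ih (by omega)).trans (hxmono i hi)
  have hy : ∀ i, i + 1 < k → x i * ε i ≤ x (i + 1) * ε (i + 1) := fun i hi =>
    mul_le_mul (hxmono i hi) (hεmono i (by omega)).le (hε i (by omega)).le (hx _ hi)
  have hy0 : 0 ≤ x 0 * ε 0 := mul_nonneg hx0 hε0.le
  have key : x k * ε k ∈ Set.Icc 0 (x (k - 1) * ε (k - 1)) := by
    rcases Nat.even_or_odd' k with ⟨m, rfl | rfl⟩
    · obtain ⟨m, rfl⟩ := Nat.exists_eq_add_of_le' (show 1 ≤ m by omega)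
      rw [hdefeven (even_two_mul _), Nat.mul_div_cancel_left _ two_pos]
      exact sum_range_odd_sub_even_mem_Icc (fun i => x i * ε i) hy0 m
        fun i hi => hy i (by omega)
    · rw [hdefodd (by simp), Nat.add_sub_cancel, Nat.mul_div_cancel_left _ two_pos]
      exact add_sum_Icc_even_sub_odd_mem_Icc (fun i => x i * ε i) hy0 m
        fun i hi => hy i (by omega)
  obtain ⟨hl, hu⟩ := key
  refine ⟨nonneg_of_mul_nonneg_left hl (hε k le_rfl), hu, fun hpos => ?_⟩
  have hlt : ε (k - 1) < ε k := by
    simpa [Nat.sub_add_cancel hk] using hεmono (k - 1) (by omega)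
  exact lt_of_mul_lt_mul_right (hu.trans_lt (mul_lt_mul_of_pos_left hlt hpos)) (hε k le_rfl).le
end

section
/- Let k ≥ 1 be an integer, let ε₀, …, ε_k be real numbers with 0 < ε₀ < ε₁ < ⋯ < ε_k and ε_k < 2·ε_{k−1}, let x₀, …, x_{k−2} be real numbers with 0 ≤ x₀ ≤ x₁ ≤ ⋯ ≤ x_{k−2} ≤ 1 (this list being empty when k = 1), and let x_k be a real number with 0 ≤ x_k ≤ 1. Define x_{k−1} by 2·x_{k−1}·ε_{k−1} = 2·∑_{j=0}^{(k−3)/2} (x_{2j+1}·ε_{2j+1} − x_{2j}·ε_{2j}) − x_k·ε_k if k is odd, and by 2·x_{k−1}·ε_{k−1} = 2·x₀·ε₀ + 2·∑_{j=1}^{(k−2)/2} (x_{2j}·ε_{2j} − x_{2j−1}·ε_{2j−1}) − x_k·ε_k if k is even. Then −1 < x_{k−1} < 1. -/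
theorem sum_odd_sub_even_mem_Icc {a : ℕ → ℝ} (h0 : 0 ≤ a 0) (m : ℕ)
    (ha : ∀ i < 2 * m + 1, a i ≤ a (i + 1)) :
    ∑ j ∈ Finset.range (m + 1), (a (2 * j + 1) - a (2 * j)) ∈ Set.Icc 0 (a (2 * m + 1)) := by
  induction m with
  | zero =>
    have := ha 0 (by omega)
    simpa using ⟨this, h0⟩
  | succ m ih =>
    obtain ⟨h1, h2⟩ := ih fun i hi => ha i (by omega)
    have h3 : a (2 * m + 1) ≤ a (2 * (m + 1)) := ha (2 * m + 1) (by omega)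
    have h4 := ha (2 * (m + 1)) (by omega)
    rw [Finset.sum_range_succ]
    constructor <;> linarith

theorem zero_add_sum_even_sub_odd_mem_Icc {a : ℕ → ℝ} (h0 : 0 ≤ a 0) (m : ℕ)
    (ha : ∀ i < 2 * m, a i ≤ a (i + 1)) :
    a 0 + ∑ j ∈ Finset.Icc 1 m, (a (2 * j) - a (2 * j - 1)) ∈ Set.Icc 0 (a (2 * m)) := by
  induction m with
  | zero => simpa using h0
  | succ m ih =>
    obtain ⟨h1, h2⟩ := ih fun i hi => ha i (by omega)
    have h3 := ha (2 * m) (by omega)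
    have h4 : a (2 * m + 1) ≤ a (2 * (m + 1)) := ha (2 * m + 1) (by omega)
    rw [Finset.sum_Icc_succ_top (by omega), show 2 * (m + 1) - 1 = 2 * m + 1 by omega]
    constructor <;> linarith


/-- given `0 < ε₀ < ⋯ < ε_k` with `ε_k < 2ε_{k−1}`,
`0 ≤ x₀ ≤ ⋯ ≤ x_{k−2} ≤ 1` (this list being empty when `k = 1`) and `0 ≤ x_k ≤ 1`, if
`x_{k−1}` is defined by
`2 x_{k−1} ε_{k−1} = 2 ∑_{j=0}^{(k−3)/2} (x_{2j+1} ε_{2j+1} − x_{2j} ε_{2j}) − x_k ε_k`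
when `k` is odd, and by
`2 x_{k−1} ε_{k−1} = 2 x₀ ε₀ + 2 ∑_{j=1}^{(k−2)/2} (x_{2j} ε_{2j} − x_{2j−1} ε_{2j−1}) − x_k ε_k`
when `k` is even, then `−1 < x_{k−1} < 1`. -/
theorem stmt10 (k : ℕ) (hk : 1 ≤ k) (ε x : ℕ → ℝ)
    (hε0 : 0 < ε 0) (hεmono : ∀ i < k, ε i < ε (i+1)) (hεk : ε k < 2 * ε (k-1))
    (hx0 : 2 ≤ k → 0 ≤ x 0) (hxmono : ∀ i, i + 3 ≤ k → x i ≤ x (i+1))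
    (hx1 : 2 ≤ k → x (k-2) ≤ 1)
    (hxk0 : 0 ≤ x k) (hxk1 : x k ≤ 1)
    (hdefodd : ¬ Even k →
      2 * x (k-1) * ε (k-1) =
        2 * ∑ j ∈ Finset.range ((k-1)/2), (x (2*j+1) * ε (2*j+1) - x (2*j) * ε (2*j))
          - x k * ε k)
    (hdefeven : Even k →
      2 * x (k-1) * ε (k-1) =
        2 * x 0 * ε 0 +
          2 * ∑ j ∈ Finset.Icc 1 ((k-2)/2), (x (2*j) * ε (2*j) - x (2*j-1) * ε (2*j-1))
          - x k * ε k) :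
    -1 < x (k-1) ∧ x (k-1) < 1 := by
  have hεpos : ∀ i ≤ k, 0 < ε i := by
    intro i
    induction i with
    | zero => exact fun _ => hε0
    | succ i ih => exact fun hi => (ih (by omega)).trans (hεmono i (by omega))
  have hxpos : ∀ i, i + 2 ≤ k → 0 ≤ x i := by
    intro i
    induction i with
    | zero => exact fun hi => hx0 (by omega)
    | succ i ih => exact fun hi => (ih (by omega)).trans (hxmono i (by omega))
  have hmono : ∀ i, i + 3 ≤ k → x i * ε i ≤ x (i + 1) * ε (i + 1) := fun i hi =>
    mul_le_mul (hxmono i hi) (hεmono i (by omega)).le (hεpos i (by omega)).le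
      (hxpos (i + 1) (by omega))
  have hpos := hεpos (k - 1) (by omega)
  have hlast : 2 ≤ k → x (k - 2) * ε (k - 2) < ε (k - 1) := fun h2 => by
    have h := hεmono (k - 2) (by omega)
    rw [show k - 2 + 1 = k - 1 by omega] at h
    exact (mul_le_of_le_one_left (hεpos (k - 2) (by omega)).le (hx1 h2)).trans_lt h
  obtain ⟨S, hS0, hS1, hS⟩ : ∃ S, 0 ≤ S ∧ S < ε (k - 1) ∧
      2 * x (k - 1) * ε (k - 1) = 2 * S - x k * ε k := by
    rcases Nat.even_or_odd' k with ⟨m, rfl | rfl⟩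
    · obtain ⟨n, rfl⟩ : ∃ n, m = n + 1 := ⟨m - 1, by omega⟩
      have h := zero_add_sum_even_sub_odd_mem_Icc (a := fun i => x i * ε i)
        (mul_nonneg (hx0 (by omega)) hε0.le) n fun i hi => hmono i (by omega)
      refine ⟨_, h.1, h.2.trans_lt (hlast (by omega)), ?_⟩
      rw [hdefeven (even_two_mul _), show (2 * (n + 1) - 2) / 2 = n by omega]
      ring
    · have hdef := hdefodd (by simp)
      rw [show (2 * m + 1 - 1) / 2 = m by omega] at hdef
      rcases m with _ | n
      · exact ⟨0, le_rfl, hpos, by simpa using hdef⟩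
      · have h := sum_odd_sub_even_mem_Icc (a := fun i => x i * ε i)
          (mul_nonneg (hx0 (by omega)) hε0.le) n fun i hi => hmono i (by omega)
        exact ⟨_, h.1, h.2.trans_lt (hlast (by omega)), hdef⟩
  have hk0 := mul_nonneg hxk0 (hεpos k le_rfl).le
  have hk1 := mul_le_of_le_one_left (hεpos k le_rfl).le hxk1
  constructor
  · exact lt_of_mul_lt_mul_right (by linarith) hpos.le
  · exact lt_of_mul_lt_mul_right (by linarith) hpos.le
end

section
/- Let d ≥ 3 and let l ≥ 0, r ≥ 0 be integers such that m := 2r + l + 1 ≤ d, and let c₁, …, c_r be real numbers with 0 ≤ c₁ ≤ c₂ ≤ ⋯ ≤ c_r < 1. Then there exist real numbers s₀, s₁, …, s_m and a real number λ ∈ [0,1) such that: s_j = s_{m−j} for all 0 ≤ j ≤ m; ∑_{j=0}^{m} s_j·√(C(d,j)·C(d,m−j)) = 0; |s_j| = c_{j+1} for every 0 ≤ j ≤ r−1; and the multiset {|s_j| : r ≤ j ≤ m−r} consists of the value 1 with multiplicity l together with the value λ with multiplicity 2. -/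
/-- Finitely many numbers in `[0, M)` have a signed sum in `[0, M)`. -/
theorem exists_signs_sum_mem_Ico {M : ℝ} (hM : 0 < M) (a : ℕ → ℝ) (n : ℕ)
    (ha : ∀ j < n, 0 ≤ a j ∧ a j < M) :
    ∃ σ : ℕ → ℝ, (∀ j, |σ j| = 1) ∧ 0 ≤ ∑ j ∈ Finset.range n, σ j * a j ∧
      ∑ j ∈ Finset.range n, σ j * a j < M := by
  induction n with
  | zero => exact ⟨fun _ => 1, by simp, by simp, by simpa using hM⟩
  | succ n ih =>
    obtain ⟨σ, hσ, h0, h1⟩ := ih fun j hj => ha j (by omega)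
    obtain ⟨han, haM⟩ := ha n (by omega)
    set S := ∑ j ∈ Finset.range n, σ j * a j with hS
    obtain ⟨e, he, hpos, hlt⟩ : ∃ e : ℝ, |e| = 1 ∧ 0 ≤ e * (S - a n) ∧ e * (S - a n) < M := by
      rcases le_total 0 (S - a n) with h | h
      · exact ⟨1, by simp, by linarith, by linarith⟩
      · exact ⟨-1, by simp, by linarith, by linarith⟩
    have hsum : ∑ j ∈ Finset.range (n + 1), (if j = n then -e else e * σ j) * a j
        = e * (S - a n) := by
      rw [Finset.sum_range_succ, if_pos rfl, hS, mul_sub, Finset.mul_sum,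
        Finset.sum_congr rfl (g := fun j => e * (σ j * a j))]
      · ring
      · intro j hj
        rw [if_neg (Finset.mem_range.mp hj).ne, mul_assoc]
    refine ⟨fun j => if j = n then -e else e * σ j, fun j => ?_, hsum ▸ hpos, hsum ▸ hlt⟩
    dsimp only
    split_ifs
    · rw [abs_neg, he]
    · rw [abs_mul, he, hσ, one_mul]

theorem sum_range_two_mul_of_symm (f : ℕ → ℝ) (n : ℕ)
    (hf : ∀ j < n, f (2 * n - 1 - j) = f j) :
    ∑ j ∈ Finset.range (2 * n), f j = 2 * ∑ j ∈ Finset.range n, f j := by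
  rw [two_mul n, Finset.sum_range_add, two_mul, ← Finset.sum_range_reflect (fun j => f (n + j))]
  congr 1
  refine Finset.sum_congr rfl fun j hj => ?_
  have hj := Finset.mem_range.mp hj
  rw [← hf j hj]
  congr 1
  omega

theorem sum_range_two_mul_add_one_of_symm (f : ℕ → ℝ) (n : ℕ)
    (hf : ∀ j < n, f (2 * n - j) = f j) :
    ∑ j ∈ Finset.range (2 * n + 1), f j = 2 * ∑ j ∈ Finset.range n, f j + f n := by
  rw [show 2 * n + 1 = n + (n + 1) by ring, Finset.sum_range_add, Finset.sum_range_succ',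
    ← Finset.sum_range_reflect (fun j => f (n + (j + 1))), two_mul, add_zero, add_assoc]
  congr 2
  refine Finset.sum_congr rfl fun j hj => ?_
  have hj := Finset.mem_range.mp hj
  rw [← hf j hj]
  congr 1
  omega

theorem choose_mul_choose_ratio (d m j : ℕ) (hj : j < m) :
    d.choose j * d.choose (m - j) * ((d - j) * (m - j)) =
      d.choose (j + 1) * d.choose (m - (j + 1)) * ((j + 1) * (d - (m - (j + 1)))) := by
  have h1 := Nat.choose_succ_right_eq d j
  have h2 := Nat.choose_succ_right_eq d (m - (j + 1))
  rw [show m - (j + 1) + 1 = m - j by omega] at h2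
  calc _ = (d.choose j * (d - j)) * (d.choose (m - j) * (m - j)) := by ring
    _ = _ := by rw [← h1, h2]; ring

theorem choose_mul_choose_lt_succ {d m j : ℕ} (hm : m ≤ d) (hj : 2 * j + 1 < m) :
    d.choose j * d.choose (m - j) < d.choose (j + 1) * d.choose (m - (j + 1)) := by
  have h := choose_mul_choose_ratio d m j (by omega)
  have hpos : 0 < d.choose (j + 1) * d.choose (m - (j + 1)) :=
    Nat.mul_pos (Nat.choose_pos (by omega)) (Nat.choose_pos (by omega))
  have hlt : (j + 1) * (d - (m - (j + 1))) < (d - j) * (m - j) := by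
    obtain ⟨p, rfl⟩ : ∃ p, m = 2 * j + 2 + p := ⟨m - (2 * j + 2), by omega⟩
    obtain ⟨q, rfl⟩ : ∃ q, d = 2 * j + 2 + p + q := ⟨d - (2 * j + 2 + p), by omega⟩
    exact Nat.mul_lt_mul'' (by omega) (by omega) |>.trans_eq (Nat.mul_comm _ _)
  by_contra! hle
  nlinarith [Nat.mul_le_mul_right ((d - j) * (m - j)) hle, Nat.mul_lt_mul_of_pos_left hlt hpos]

theorem choose_mul_choose_center_lt {d k : ℕ} (hd : 3 ≤ d) (hk : 2 * k + 2 ≤ d) :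
    d.choose (k + 1) * d.choose (2 * k + 2 - (k + 1)) <
      4 * (d.choose k * d.choose (2 * k + 2 - k)) := by
  have h := choose_mul_choose_ratio d (2 * k + 2) k (by omega)
  have hpos : 0 < d.choose k * d.choose (2 * k + 2 - k) :=
    Nat.mul_pos (Nat.choose_pos (by omega)) (Nat.choose_pos (by omega))
  have hlt : (d - k) * (2 * k + 2 - k) < 4 * ((k + 1) * (d - (2 * k + 2 - (k + 1)))) := by
    obtain ⟨p, rfl⟩ : ∃ p, d = 2 * k + 2 + p := ⟨d - (2 * k + 2), by omega⟩
    rw [show 2 * k + 2 + p - k = k + 2 + p by omega, show 2 * k + 2 - k = k + 2 by omega,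
      show 2 * k + 2 + p - (2 * k + 2 - (k + 1)) = k + 1 + p by omega]
    rcases Nat.eq_zero_or_pos k with rfl | hk0
    · omega
    · nlinarith [Nat.zero_le (k * p)]
  by_contra! hle
  nlinarith [Nat.mul_le_mul_right ((k + 1) * (d - (2 * k + 2 - (k + 1)))) hle,
    Nat.mul_lt_mul_of_pos_left hlt hpos]

theorem map_range_val_eq_replicate_add {n p q : ℕ} (f : ℕ → ℝ) (a b : ℝ) (hp : p < n + 2)
    (hq : q < n + 2) (hpq : p ≠ q) (hfp : f p = b) (hfq : f q = b)
    (hf : ∀ j < n + 2, j ≠ p → j ≠ q → f j = a) :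
    Multiset.map f (Finset.range (n + 2)).val =
      Multiset.replicate n a + Multiset.replicate 2 b := by
  have hq' : q ∈ (Finset.range (n + 2)).erase p := by simp [hpq.symm, hq]
  have hp' : p ∈ Finset.range (n + 2) := by simp [hp]
  have hcard : (((Finset.range (n + 2)).erase p).erase q).card = n := by
    rw [Finset.card_erase_of_mem hq', Finset.card_erase_of_mem hp', Finset.card_range]
    omega
  have hrest : Multiset.map f (((Finset.range (n + 2)).erase p).erase q).val =
      Multiset.replicate n a := by
    rw [Multiset.map_congr rfl (g := fun _ => a), Multiset.map_const', Finset.card_val, hcard]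
    intro j hj
    simp only [Finset.mem_val, Finset.mem_erase, Finset.mem_range] at hj
    exact hf j hj.2.2 hj.2.1 hj.1
  rw [← Finset.insert_erase hp', Finset.insert_val_of_notMem (by simp),
    ← Finset.insert_erase hq', Finset.insert_val_of_notMem (by simp), Multiset.map_cons,
    Multiset.map_cons, hrest, hfp, hfq]
  rw [add_comm]
  simp [Multiset.replicate_succ]


/-- let `d ≥ 3`, `l, r ≥ 0` with `m := 2r+l+1 ≤ d`, and
`0 ≤ c₁ ≤ ⋯ ≤ c_r < 1`. Then there exist reals `s₀, …, s_m` (symmetric: `s_j = s_{m−j}`) with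
`∑_{j=0}^m s_j √(C(d,j) C(d,m−j)) = 0`, `|s_j| = c_{j+1}` for `0 ≤ j ≤ r−1`, and such that the
multiset `{|s_j| : r ≤ j ≤ m−r}` consists of `1` with multiplicity `l` together with some
`λ ∈ [0,1)` with multiplicity `2`. -/
theorem stmt11 (d l r : ℕ) (hd : 3 ≤ d) (hm : 2*r + l + 1 ≤ d)
    (c : ℕ → ℝ) (hc0 : 1 ≤ r → 0 ≤ c 1)
    (hcmono : ∀ i, 1 ≤ i → i + 1 ≤ r → c i ≤ c (i+1))
    (hcr : 1 ≤ r → c r < 1) :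
    ∃ (s : ℕ → ℝ) (lam : ℝ), 0 ≤ lam ∧ lam < 1 ∧
      (∀ j ≤ 2*r + l + 1, s j = s (2*r + l + 1 - j)) ∧
      (∑ j ∈ Finset.range (2*r + l + 2),
        s j * Real.sqrt ((d.choose j : ℝ) * (d.choose (2*r + l + 1 - j) : ℝ)) = 0) ∧
      (∀ j < r, |s j| = c (j+1)) ∧
      (Multiset.map (fun j => |s (r + j)|) (Finset.range (l + 2)).val =
        Multiset.replicate l (1:ℝ) + Multiset.replicate 2 lam) := by
  have hc : ∀ j < r, 0 ≤ c (j + 1) ∧ c (j + 1) < 1 := by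
    have hmono : MonotoneOn c (Set.Icc 1 r) :=
      monotoneOn_of_le_succ Set.ordConnected_Icc fun i _ hi hi' => hcmono i hi.1 hi'.2
    intro j hj
    have hmem : j + 1 ∈ Set.Icc 1 r := ⟨by omega, by omega⟩
    exact ⟨(hc0 (by omega)).trans (hmono ⟨le_rfl, by omega⟩ hmem (by omega)),
      (hmono hmem ⟨by omega, le_rfl⟩ (by omega)).trans_lt (hcr (by omega))⟩
  set m := 2 * r + l + 1 with hmdef
  set k := r + l / 2 with hk
  set w : ℕ → ℝ := fun j => Real.sqrt ((d.choose j : ℝ) * (d.choose (m - j) : ℝ)) with hw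
  have hwpos : ∀ j ≤ m, 0 < w j := fun j hj => Real.sqrt_pos.mpr <| mul_pos
    (Nat.cast_pos.mpr (Nat.choose_pos (by omega))) (Nat.cast_pos.mpr (Nat.choose_pos (by omega)))
  have hwsucc : ∀ j, 2 * j + 1 < m → w j < w (j + 1) := fun j hj =>
    Real.sqrt_lt_sqrt (by positivity) (mod_cast choose_mul_choose_lt_succ hm hj)
  have hwk : ∀ j < k, w j < w k := by
    have hmono : StrictMonoOn w (Set.Icc 0 k) :=
      strictMonoOn_of_lt_succ Set.ordConnected_Icc fun i _ _ hi' => hwsucc i (by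
        have := hi'.2
        simp only [Order.succ_eq_add_one] at this
        omega)
    exact fun j hj => hmono ⟨by omega, hj.le⟩ ⟨by omega, le_rfl⟩ hj
  have hwsymm : ∀ j ≤ m, w (m - j) = w j := fun j hj => by
    simp only [hw, Nat.sub_sub_self hj, mul_comm]
  have hk0 : 0 < w k := hwpos k (by omega)
  set u : ℕ → ℝ := fun j => if j < r then c (j + 1) else 1 with hu
  have hu01 : ∀ j, 0 ≤ u j ∧ u j ≤ 1 := fun j => by
    simp only [hu]
    split_ifs with h
    · exact ⟨(hc j h).1, (hc j h).2.le⟩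
    · norm_num
  obtain ⟨σ, hσ, hA0, hA1⟩ := exists_signs_sum_mem_Ico hk0 (fun j => u j * w j) k fun j hj =>
    ⟨mul_nonneg (hu01 j).1 (hwpos j (by omega)).le,
      (mul_le_of_le_one_left (hwpos j (by omega)).le (hu01 j).2).trans_lt (hwk j hj)⟩
  set A := ∑ j ∈ Finset.range k, σ j * (u j * w j) with hA
  obtain ⟨x, hx, hxsum⟩ : ∃ x : ℝ, |x| < 1 ∧
      2 * (A - x * w k) - (if l % 2 = 0 then 0 else w (k + 1)) = 0 := by
    set B : ℝ := if l % 2 = 0 then 0 else w (k + 1) with hB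
    have hB0 : 0 ≤ B := by
      rw [hB]; split_ifs
      exacts [le_rfl, (hwpos _ (by omega)).le]
    have hB2 : B < 2 * w k := by
      rw [hB]; split_ifs with h
      · linarith
      · have h2 : m = 2 * k + 2 := by omega
        refine lt_of_pow_lt_pow_left₀ 2 (by positivity) ?_
        have := choose_mul_choose_center_lt (k := k) hd (by omega)
        rw [← h2] at this
        rw [mul_pow, hw, Real.sq_sqrt (by positivity), Real.sq_sqrt (by positivity)]
        norm_num
        exact mod_cast this
    refine ⟨(A - B / 2) / w k, ?_, by field_simp; ring⟩
    rw [abs_div, abs_of_pos hk0, div_lt_one hk0, abs_lt]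
    constructor <;> linarith
  set t : ℕ → ℝ := fun j => if j < k then σ j * u j else if j = k then -x else -1 with ht
  have htsum : ∑ j ∈ Finset.range (k + 1), t j * w j = A - x * w k := by
    rw [Finset.sum_range_succ, Finset.sum_congr rfl (g := fun j => σ j * (u j * w j))]
    · simp [ht, hA, sub_eq_add_neg]
    · intro j hj
      simp only [ht, if_pos (Finset.mem_range.mp hj), mul_assoc]
  set s : ℕ → ℝ := fun j => t (min j (m - j)) with hs
  have hssymm : ∀ j ≤ m, s (m - j) = s j := fun j hj => by
    simp only [hs, Nat.sub_sub_self hj, min_comm]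
  have hst : ∀ j, 2 * j ≤ m → s j = t j := fun j hj => by
    simp only [hs, min_eq_left (show j ≤ m - j by omega)]
  have hsum : ∑ j ∈ Finset.range (k + 1), s j * w j = A - x * w k := by
    rw [← htsum]
    refine Finset.sum_congr rfl fun j hj => ?_
    have := Finset.mem_range.mp hj
    rw [hst j (by omega)]
  have hf : ∀ j ≤ m, s (m - j) * w (m - j) = s j * w j := fun j hj => by
    rw [hssymm j hj, hwsymm j hj]
  refine ⟨s, |x|, abs_nonneg x, hx, fun j hj => (hssymm j hj).symm, ?_, fun j hj => ?_, ?_⟩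
  · change ∑ j ∈ Finset.range (m + 1), s j * w j = 0
    rw [← hxsum]
    split_ifs with h
    · have h2 : m + 1 = 2 * (k + 1) := by omega
      rw [h2, sum_range_two_mul_of_symm, hsum, sub_zero]
      intro j hj
      rw [← h2, Nat.add_sub_cancel]
      exact hf j (by omega)
    · have h2 : m = 2 * (k + 1) := by omega
      rw [h2, sum_range_two_mul_add_one_of_symm, hsum, hst (k + 1) (by omega)]
      · simp [ht, sub_eq_add_neg]
      · intro j hj
        rw [← h2]
        exact hf j (by omega)
  · rw [hst j (by omega)]
    simp only [ht, hu, if_pos (show j < k by omega), if_pos hj, abs_mul, hσ, one_mul,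
      abs_of_nonneg (hc j hj).1]
  · have hmin : ∀ j < l + 2, min (r + j) (m - (r + j)) = r + min j (l + 1 - j) := by omega
    refine map_range_val_eq_replicate_add (p := l / 2) (q := l + 1 - l / 2) _ _ _ (by omega)
      (by omega) (by omega) ?_ ?_ fun j hj hj1 hj2 => ?_
    · simp only [hs, ht, show min (r + l / 2) (m - (r + l / 2)) = k by omega]
      simp
    · simp only [hs, ht, show min (r + (l + 1 - l / 2)) (m - (r + (l + 1 - l / 2))) = k by omega]
      simp
    · simp only [hs, hmin j hj]
      by_cases h : r + min j (l + 1 - j) < k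
      · simp [ht, hu, h, hσ]
      · have hne : r + min j (l + 1 - j) ≠ k := by omega
        simp only [ht, if_neg h, if_neg hne]
        simp
end

section
/- Let d ≥ 2 and let m be an integer with 2 ≤ m ≤ d. Then there exist real numbers s₀, s₁, …, s_m, all nonzero and with |s_j| ≤ 1, such that s_j = s_{m−j} for every 0 ≤ j ≤ m and ∑_{j=0}^{m} s_j·√(C(d,j)·C(d,m−j)) = 0. -/
/-- Positive weights admit a nonzero symmetric sequence in `[-1, 1]` orthogonal to them: take one
constant at the two end indices and a constant of the opposite sign in between. -/
theorem exists_symmetric_orthogonal_of_pos (n : ℕ) (w : ℕ → ℝ) (hw : ∀ j ≤ n + 2, 0 < w j) :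
    ∃ s : ℕ → ℝ, (∀ j ≤ n + 2, s j ≠ 0 ∧ |s j| ≤ 1 ∧ s j = s (n + 2 - j)) ∧
      ∑ j ∈ Finset.range (n + 2 + 1), s j * w j = 0 := by
  set a := w 0 + w (n + 2) with ha
  set b := ∑ i ∈ Finset.range (n + 1), w (i + 1) with hb
  have ha0 : 0 < a := add_pos (hw _ (by omega)) (hw _ le_rfl)
  have hb0 : 0 < b := Finset.sum_pos
    (fun i hi => hw _ (by have := Finset.mem_range.mp hi; omega)) ⟨0, by simp⟩
  have hab : 0 < a + b := add_pos ha0 hb0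
  refine ⟨fun j => if j = 0 ∨ j = n + 2 then b / (a + b) else -(a / (a + b)),
    fun j hj => ⟨?_, ?_, ?_⟩, ?_⟩
  · dsimp only
    split_ifs
    · positivity
    · exact neg_ne_zero.mpr (by positivity)
  · dsimp only
    split_ifs
    · rw [abs_of_pos (by positivity), div_le_one hab]
      linarith
    · rw [abs_neg, abs_of_pos (by positivity), div_le_one hab]
      linarith
  · exact if_congr (by omega) rfl rfl
  · have hinner : ∑ i ∈ Finset.range (n + 1),
        (if i + 1 = 0 ∨ i + 1 = n + 2 then b / (a + b) else -(a / (a + b))) * w (i + 1) =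
          -(a / (a + b)) * b := by
      rw [hb, Finset.mul_sum]
      refine Finset.sum_congr rfl fun i hi => ?_
      have := Finset.mem_range.mp hi
      rw [if_neg (by omega)]
    rw [Finset.sum_range_succ, Finset.sum_range_succ', hinner]
    simp only [true_or, or_true, if_true]
    linear_combination -(b / (a + b)) * ha

/-- for `d ≥ 2` and `2 ≤ m ≤ d` there exist nonzero reals `s₀, …, s_m` with
`|s_j| ≤ 1`, `s_j = s_{m−j}`, and `∑_{j=0}^m s_j √(C(d,j)·C(d,m−j)) = 0`. -/
theorem stmt12 (d m : ℕ) (hd : 2 ≤ d) (hm2 : 2 ≤ m) (hmd : m ≤ d) :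
    ∃ s : ℕ → ℝ, (∀ j ≤ m, s j ≠ 0 ∧ |s j| ≤ 1 ∧ s j = s (m - j)) ∧
      ∑ j ∈ Finset.range (m+1),
        s j * Real.sqrt ((d.choose j : ℝ) * (d.choose (m - j) : ℝ)) = 0 := by
  obtain ⟨n, rfl⟩ := Nat.exists_eq_add_of_le' hm2
  refine exists_symmetric_orthogonal_of_pos n
    (fun j => Real.sqrt ((d.choose j : ℝ) * (d.choose (n + 2 - j) : ℝ))) fun j hj => ?_
  have h₁ : 0 < d.choose j := Nat.choose_pos (by omega)
  have h₂ : 0 < d.choose (n + 2 - j) := Nat.choose_pos (by omega)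
  positivity
end
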